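/- Let p be an odd prime and let G be a quasi-powerful p-group. If x, y, z, w ∈ G with x^p = y^p = z^p = 1, then the iterated commutator [[[x,y],z],w] = 1. -/

import Mathlib

/-- The subgroup of `G` generated by all `n`-th powers. -/
def powSubgroup (G : Type*) [Group G] (n : ℕ) : Subgroup G :=
  Subgroup.closure {x : G | ∃ g : G, g ^ n = x}

/-- `Ω_k`-type subgroup: generated by all elements whose `n`-th power is trivial. -/
def omegaSubgroup (G : Type*) [Group G] (n : ℕ) : Subgroup G :=
  Subgroup.closure {g : G | g ^ n = 1}

/-- A group is powerful (for a prime `p`) if `[G,G] ≤ G^p`. -/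
def IsPowerful (p : ℕ) (G : Type*) [Group G] : Prop :=
  commutator G ≤ powSubgroup G p

/-- A group is quasi-powerful (for a prime `p`) if `G/Z(G)` is powerful. -/
def IsQuasiPowerful (p : ℕ) (G : Type*) [Group G] : Prop :=
  IsPowerful p (G ⧸ Subgroup.center G)

/-- The commutator `[x,y] = x⁻¹y⁻¹xy`. -/
def pcomm {G : Type*} [Group G] (a b : G) : G := a⁻¹ * b⁻¹ * a * b

open Subgroup

theorem pcomm_eq_one_iff {G : Type*} [Group G] {a b : G} : pcomm a b = 1 ↔ Commute a b := by
  rw [commute_iff_eq, pcomm, mul_assoc, ← mul_inv_rev, inv_mul_eq_one, eq_comm]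

theorem mul_pcomm {G : Type*} [Group G] (a b : G) : a * pcomm a b = b⁻¹ * a * b := by
  simp [pcomm, mul_assoc]

theorem map_pcomm {G H : Type*} [Group G] [Group H] (f : G →* H) (a b : G) :
    f (pcomm a b) = pcomm (f a) (f b) := by
  simp [pcomm]

theorem pcomm_mem_commutator {G : Type*} [Group G] {H K : Subgroup G} {a b : G}
    (ha : a ∈ H) (hb : b ∈ K) : pcomm a b ∈ ⁅H, K⁆ := by
  simpa [pcomm, commutatorElement_def] using
    commutator_mem_commutator (H.inv_mem ha) (K.inv_mem hb)

/-- If `[c, a]` commutes with `a` and `c` and its order divides the odd number `p`, then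
`(a c)^p = a^p c^p`. -/
theorem mul_pow_of_pcomm_pow_eq_one {G : Type*} [Group G] {p : ℕ} (hodd : Odd p) {a c : G}
    (hfa : Commute (pcomm c a) a) (hfc : Commute (pcomm c a) c) (hfp : pcomm c a ^ p = 1) :
    (a * c) ^ p = a ^ p * c ^ p := by
  set f := pcomm c a with hf
  have hca : c * a = a * (c * f) := by rw [hf, mul_pcomm]; simp [mul_assoc]
  have hcka : ∀ k : ℕ, c ^ k * a = a * (c ^ k * f ^ k) := by
    intro k
    rw [← hfc.symm.mul_pow]
    exact (SemiconjBy.pow_right (show SemiconjBy a (c * f) c from hca.symm) k).eq.symm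
  have key : ∀ k : ℕ, (a * c) ^ k = a ^ k * (c ^ k * f ^ k.choose 2) := by
    intro k
    induction k with
    | zero => simp
    | succ k ih =>
      rw [pow_succ, ih, Nat.choose_succ_succ' k 1, Nat.choose_one_right]
      calc a ^ k * (c ^ k * f ^ k.choose 2) * (a * c)
          = a ^ k * (c ^ k * (f ^ k.choose 2 * (a * c))) := by simp only [mul_assoc]
        _ = a ^ k * (c ^ k * a * c * f ^ k.choose 2) := by
          rw [((hfa.mul_right hfc).pow_left _).eq]; simp only [mul_assoc]
        _ = a ^ k * (a * (c ^ k * (f ^ k * c)) * f ^ k.choose 2) := by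
          rw [hcka]; simp only [mul_assoc]
        _ = a ^ (k + 1) * (c ^ (k + 1) * f ^ (k + k.choose 2)) := by
          rw [(hfc.pow_left k).eq]; simp only [pow_succ, pow_add, mul_assoc]
  obtain ⟨m, hm⟩ := hodd
  have h2 : p.choose 2 = p * m := by
    rw [Nat.choose_two_right, hm, Nat.add_sub_cancel, mul_left_comm,
      Nat.mul_div_cancel_left _ two_pos]
  rw [key, h2, pow_mul, hfp, one_pow, mul_one]

theorem conj_pow_eq_one {G : Type*} [Group G] {n : ℕ} {a : G} (h : a ^ n = 1) (b : G) :
    (b⁻¹ * a * b) ^ n = 1 := by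
  simpa [h] using conj_pow (i := n) (a := b⁻¹) (b := a)

theorem pcomm_pow_eq_one_of_commute {G : Type*} [Group G] {n : ℕ} {a c : G}
    (hfc : Commute (pcomm c a) c) (hc : c ^ n = 1) : pcomm c a ^ n = 1 := by
  have h := conj_pow_eq_one hc a
  rwa [← mul_pcomm, hfc.symm.mul_pow, hc, one_mul] at h

theorem commute_pow_of_commute_pcomm {G : Type*} [Group G] {p : ℕ} (hodd : Odd p) {a b : G}
    (hc : pcomm a b ^ p = 1) (hfa : Commute (pcomm (pcomm a b) a) a)
    (hfc : Commute (pcomm (pcomm a b) a) (pcomm a b)) : Commute (a ^ p) b := by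
  have h := mul_pow_of_pcomm_pow_eq_one hodd hfa hfc (pcomm_pow_eq_one_of_commute hfc hc)
  rw [hc, mul_one, mul_pcomm, show b⁻¹ * a * b = b⁻¹ * a * b⁻¹⁻¹ by simp, conj_pow, inv_inv,
    mul_assoc, inv_mul_eq_iff_eq_mul] at h
  exact h

theorem le_of_le_sup_commutator {G : Type*} [Group G] [Group.IsNilpotent G] {A N : Subgroup G}
    [N.Normal] (h : A ≤ N ⊔ ⁅A, ⊤⁆) : A ≤ N := by
  set π := QuotientGroup.mk' N
  have hA : A.map π ≤ ⁅A.map π, ⊤⁆ := by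
    have := map_mono (f := π) h
    rwa [Subgroup.map_sup, map_commutator, QuotientGroup.map_mk'_self, bot_sup_eq,
      map_top_of_surjective _ (QuotientGroup.mk'_surjective N)] at this
  obtain ⟨n, hn⟩ := Subgroup.nilpotent_iff_lowerCentralSeries.1
    (inferInstance : Group.IsNilpotent (G ⧸ N))
  have hle : ∀ k, A.map π ≤ (⊤ : Subgroup (G ⧸ N)).lowerCentralSeries k := by
    intro k
    induction k with
    | zero => simp
    | succ k ih => exact hA.trans (commutator_mono ih le_rfl)
  have hbot : A.map π = ⊥ := le_bot_iff.1 (hn ▸ hle n)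
  rwa [Subgroup.map_eq_bot_iff, QuotientGroup.ker_mk'] at hbot

theorem pow_mem_powSubgroup {G : Type*} [Group G] (n : ℕ) (g : G) : g ^ n ∈ powSubgroup G n :=
  subset_closure ⟨g, rfl⟩

theorem map_powSubgroup {G H : Type*} [Group G] [Group H] (f : G →* H)
    (hf : Function.Surjective f) (n : ℕ) : (powSubgroup G n).map f = powSubgroup H n := by
  rw [powSubgroup, powSubgroup, MonoidHom.map_closure]
  congr 1
  ext x
  constructor
  · rintro ⟨_, ⟨g, rfl⟩, rfl⟩
    exact ⟨f g, by simp⟩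
  · rintro ⟨h, rfl⟩
    obtain ⟨g, rfl⟩ := hf h
    exact ⟨g ^ n, ⟨g, rfl⟩, by simp⟩

instance powSubgroup_characteristic (G : Type*) [Group G] (n : ℕ) :
    (powSubgroup G n).Characteristic :=
  characteristic_iff_map_eq.2 fun φ => map_powSubgroup φ.toMonoidHom φ.surjective n

theorem map_subtype_powSubgroup_mono {G : Type*} [Group G] {H K : Subgroup G} (h : H ≤ K) (n : ℕ) :
    (powSubgroup H n).map H.subtype ≤ (powSubgroup K n).map K.subtype := by
  rw [powSubgroup, MonoidHom.map_closure, closure_le]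
  rintro _ ⟨_, ⟨g, rfl⟩, rfl⟩
  exact ⟨_, pow_mem_powSubgroup n ⟨g, h g.2⟩, rfl⟩

theorem IsPowerful.of_surjective {p : ℕ} {G H : Type*} [Group G] [Group H] (hG : IsPowerful p G)
    (f : G →* H) (hf : Function.Surjective f) : IsPowerful p H := by
  have := map_mono (f := f) hG
  rwa [map_powSubgroup f hf, commutator_def, map_commutator, map_top_of_surjective f hf] at this

theorem isPowerful_coe_iff {p : ℕ} {G : Type*} [Group G] {H : Subgroup G} :
    IsPowerful p H ↔ ⁅H, H⁆ ≤ (powSubgroup H p).map H.subtype := by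
  rw [← map_subtype_commutator, map_subtype_le_map_subtype, IsPowerful]

/-- In a powerful `p`-group `G` with `p` odd, `[G^p, G] ≤ (G^p)^p`. -/
theorem IsPowerful.commutator_powSubgroup_le {p : ℕ} {G : Type*} [Group G] [Group.IsNilpotent G]
    (hodd : Odd p) (hP : IsPowerful p G) :
    ⁅powSubgroup G p, ⊤⁆ ≤
      (powSubgroup (powSubgroup G p) p).map (powSubgroup G p).subtype := by
  set N := (powSubgroup (powSubgroup G p) p).map (powSubgroup G p).subtype
  have : N.Normal := ConjAct.normal_of_characteristic_of_normal
  apply le_of_le_sup_commutator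
  set A := ⁅powSubgroup G p, (⊤ : Subgroup G)⁆
  set B := N ⊔ ⁅A, ⊤⁆
  set π := QuotientGroup.mk' B
  have hpow : ∀ t ∈ powSubgroup G p, π t ^ p = 1 := by
    intro t ht
    rw [← map_pow, ← MonoidHom.mem_ker, QuotientGroup.ker_mk']
    exact mem_sup_left ⟨_, pow_mem_powSubgroup p ⟨t, ht⟩, rfl⟩
  have hcent : ∀ t ∈ A, ∀ b, Commute (π t) (π b) := by
    intro t ht b
    rw [← pcomm_eq_one_iff, ← map_pcomm, ← MonoidHom.mem_ker, QuotientGroup.ker_mk']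
    exact mem_sup_right (pcomm_mem_commutator ht (mem_top b))
  have hmem : ∀ a b : G, pcomm a b ∈ powSubgroup G p := fun a b =>
    hP (pcomm_mem_commutator (mem_top a) (mem_top b))
  have hcom : ∀ a b : G, Commute (π a ^ p) (π b) := by
    intro a b
    have hf : pcomm (pcomm a b) a ∈ A := pcomm_mem_commutator (hmem a b) (mem_top a)
    apply commute_pow_of_commute_pcomm hodd
    · rw [← map_pcomm]; exact hpow _ (hmem a b)
    · rw [← map_pcomm, ← map_pcomm]; exact hcent _ hf _
    · rw [← map_pcomm, ← map_pcomm]; exact hcent _ hf _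
  rw [← QuotientGroup.ker_mk' B, ← Subgroup.map_eq_bot_iff]
  refine (map_commutator _ _ _).trans ?_
  rw [map_top_of_surjective _ (QuotientGroup.mk'_surjective B),
    commutator_top_right_eq_bot_iff_le_center, map_le_iff_le_comap]
  conv_lhs => rw [powSubgroup]
  rw [closure_le]
  rintro _ ⟨g, rfl⟩
  refine mem_center_iff.2 fun b => ?_
  obtain ⟨b, rfl⟩ := QuotientGroup.mk'_surjective B b
  rw [map_pow]
  exact (hcom g b).symm

theorem IsPowerful.isPowerful_powSubgroup {p : ℕ} {G : Type*} [Group G] [Group.IsNilpotent G]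
    (hodd : Odd p) (hP : IsPowerful p G) : IsPowerful p (powSubgroup G p) :=
  isPowerful_coe_iff.2 <|
    (commutator_mono le_rfl le_top).trans (hP.commutator_powSubgroup_le hodd)

theorem IsPowerful.pcomm_mem {p : ℕ} {G : Type*} [Group G] (hP : IsPowerful p G) (a b : G) :
    pcomm a b ∈ powSubgroup G p :=
  hP (pcomm_mem_commutator (mem_top a) (mem_top b))

theorem IsPowerful.zpowers_sup_powSubgroup {p : ℕ} {G : Type*} [Group G] [Group.IsNilpotent G]
    (hodd : Odd p) (hP : IsPowerful p G) (g : G) :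
    IsPowerful p (zpowers g ⊔ powSubgroup G p : Subgroup G) := by
  set N := (powSubgroup (powSubgroup G p) p).map
    (powSubgroup G p).subtype with hN
  have : N.Normal := ConjAct.normal_of_characteristic_of_normal
  refine isPowerful_coe_iff.2 (le_trans ?_ (map_subtype_powSubgroup_mono le_sup_right p))
  set π := QuotientGroup.mk' N
  have hcent : ∀ t ∈ powSubgroup G p, ∀ b, Commute (π t) (π b) := by
    intro t ht b
    rw [← pcomm_eq_one_iff, ← map_pcomm, ← MonoidHom.mem_ker, QuotientGroup.ker_mk']
    exact hP.commutator_powSubgroup_le hodd (pcomm_mem_commutator ht (mem_top b))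
  rw [commutator_le]
  intro a ha b hb
  obtain ⟨_, ⟨i, rfl⟩, u, hu, rfl⟩ := mem_sup_of_normal_right.1 ha
  obtain ⟨_, ⟨j, rfl⟩, v, hv, rfl⟩ := mem_sup_of_normal_right.1 hb
  rw [← hN, ← QuotientGroup.ker_mk' N, MonoidHom.mem_ker, map_commutatorElement,
    commutatorElement_eq_one_iff_commute, map_mul]
  refine Commute.mul_left ?_ (hcent u hu _)
  rw [map_mul]
  refine Commute.mul_right ?_ (hcent v hv _).symm
  simp only [map_zpow]
  exact (Commute.refl _).zpow_zpow i j

theorem IsPGroup.powSubgroup_le_frattini {p : ℕ} [Fact p.Prime] {G : Type*} [Group G] [Finite G]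
    (hG : IsPGroup p G) : powSubgroup G p ≤ frattini G := by
  have : Group.IsNilpotent G := hG.isNilpotent
  refine le_iInf₂ fun M hM => ?_
  have : M.Normal := Group.normalizerCondition_of_isNilpotent.normal_of_coatom M hM
  rw [powSubgroup, closure_le]
  rintro _ ⟨y, rfl⟩
  by_contra hy
  have htop : M ⊔ zpowers (y ^ p) = ⊤ := by
    refine hM.2 _ (lt_of_le_of_ne le_sup_left fun h => hy ?_)
    rw [SetLike.mem_coe, h]
    exact mem_sup_right (mem_zpowers _)
  obtain ⟨m, hm, _, ⟨k, rfl⟩, hmk⟩ := mem_sup_of_normal_left.1 (htop ▸ mem_top y)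
  set q := QuotientGroup.mk' M y with hq
  have hqk : q = (q ^ p) ^ k := by
    have := congrArg (QuotientGroup.mk' M) hmk
    rw [map_mul, (MonoidHom.mem_ker (f := QuotientGroup.mk' M)).1
      (by rwa [QuotientGroup.ker_mk']), one_mul] at this
    simpa [hq] using this.symm
  have hqj : ∀ j : ℕ, q = (q ^ p ^ j) ^ k ^ j := by
    intro j
    induction j with
    | zero => simp
    | succ j ih =>
      conv_lhs => rw [ih, hqk]
      simp only [← zpow_natCast, ← zpow_mul]
      congr 1
      push_cast
      ring
  obtain ⟨j, hj⟩ := hG y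
  apply hy
  refine M.pow_mem ?_ p
  rw [← QuotientGroup.ker_mk' M, MonoidHom.mem_ker, ← hq, hqj j, hq, ← map_pow, hj]
  simp

theorem IsPGroup.zpowers_eq_top_of_sup {p : ℕ} [Fact p.Prime] {G : Type*} [Group G] [Finite G]
    (hG : IsPGroup p G) {g : G} (h : zpowers g ⊔ powSubgroup G p = ⊤) : zpowers g = ⊤ :=
  frattini_nongenerating (top_le_iff.1 (h ▸ sup_le_sup_left hG.powSubgroup_le_frattini _))

theorem IsPGroup.subsingleton_of_powSubgroup_eq_top {p : ℕ} [Fact p.Prime] {G : Type*} [Group G]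
    [Finite G] (hG : IsPGroup p G) (h : powSubgroup G p = ⊤) : Subsingleton G := by
  have h1 : zpowers (1 : G) = ⊤ := hG.zpowers_eq_top_of_sup (by rw [h, sup_top_eq])
  rw [zpowers_one_eq_bot] at h1
  exact subsingleton_iff.1 (subsingleton_of_bot_eq_top h1)

theorem card_subgroup_lt {G : Type*} [Group G] [Finite G] {H : Subgroup G} (h : H ≠ ⊤) :
    Nat.card H < Nat.card G :=
  lt_of_le_of_ne (card_le_card_group H) fun h' => h (eq_top_of_card_eq H h')

/-- In a powerful `p`-group with `p` odd, every product of `p`-th powers is a `p`-th power. -/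
theorem IsPowerful.exists_pow_eq {p : ℕ} [Fact p.Prime] (hodd : Odd p) {G : Type*} [Group G]
    [Finite G] (hG : IsPGroup p G) (hP : IsPowerful p G) {x : G}
    (hx : x ∈ powSubgroup G p) : ∃ g, g ^ p = x := by
  induction hn : Nat.card G using Nat.strong_induction_on generalizing G with
  | _ n ih =>
  have : Group.IsNilpotent G := hG.isNilpotent
  set N := (powSubgroup (powSubgroup G p) p).map
    (powSubgroup G p).subtype
  have : N.Normal := ConjAct.normal_of_characteristic_of_normal
  set π := QuotientGroup.mk' N
  have hmul : ∀ a b : G, π (a * b) ^ p = π a ^ p * π b ^ p := by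
    intro a b
    have hc : ∀ t, Commute (pcomm (π b) (π a)) (π t) := fun t => by
      rw [← pcomm_eq_one_iff, ← map_pcomm, ← map_pcomm, ← MonoidHom.mem_ker,
        QuotientGroup.ker_mk']
      exact hP.commutator_powSubgroup_le hodd
        (pcomm_mem_commutator (hP.pcomm_mem b a) (mem_top t))
    rw [map_mul]
    refine mul_pow_of_pcomm_pow_eq_one hodd (hc a) (hc b) ?_
    rw [← map_pcomm, ← map_pow, ← MonoidHom.mem_ker, QuotientGroup.ker_mk']
    exact ⟨_, pow_mem_powSubgroup p ⟨_, hP.pcomm_mem b a⟩, rfl⟩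
  have hg : ∃ g, π g ^ p = π x := by
    induction hx using closure_induction with
    | mem x hx => obtain ⟨g, rfl⟩ := hx; exact ⟨g, by simp⟩
    | one => exact ⟨1, by simp⟩
    | mul x y _ _ hx hy =>
      obtain ⟨g, hg⟩ := hx
      obtain ⟨h, hh⟩ := hy
      exact ⟨g * h, by rw [hmul, hg, hh, map_mul]⟩
    | inv x _ hx => obtain ⟨g, hg⟩ := hx; exact ⟨g⁻¹, by simp [← hg]⟩
  obtain ⟨g, hg⟩ := hg
  have hgx : (g ^ p)⁻¹ * x ∈ N := by
    rw [← QuotientGroup.ker_mk' N, MonoidHom.mem_ker, map_mul, map_inv, map_pow, hg,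
      inv_mul_cancel]
  set K := zpowers g ⊔ powSubgroup G p
  by_cases hKtop : K = ⊤
  · have hgtop : zpowers g = ⊤ := hG.zpowers_eq_top_of_sup hKtop
    have hle : powSubgroup G p ≤ zpowers (g ^ p) := by
      rw [powSubgroup, closure_le]
      rintro _ ⟨h, rfl⟩
      obtain ⟨k, rfl⟩ := mem_zpowers_iff.1 (hgtop ▸ mem_top h)
      exact ⟨k, by simp only [← zpow_natCast, ← zpow_mul, mul_comm]⟩
    obtain ⟨k, rfl⟩ := mem_zpowers_iff.1 (hle hx)
    exact ⟨g ^ k, by simp only [← zpow_natCast, ← zpow_mul, mul_comm]⟩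
  · have hxK : x ∈ (powSubgroup K p).map K.subtype := by
      have hgK : g ^ p ∈ (powSubgroup K p).map K.subtype :=
        ⟨_, pow_mem_powSubgroup p ⟨g, mem_sup_left (mem_zpowers g)⟩, rfl⟩
      simpa using mul_mem hgK (map_subtype_powSubgroup_mono le_sup_right p hgx)
    obtain ⟨x', hx', rfl⟩ := hxK
    obtain ⟨k, rfl⟩ := ih _ (hn ▸ card_subgroup_lt hKtop) (hG.to_subgroup K)
      (hP.zpowers_sup_powSubgroup hodd g) hx' rfl
    exact ⟨k, by simp⟩

theorem IsPowerful.exists_pcomm_eq_pow_sq {p : ℕ} [Fact p.Prime] (hodd : Odd p) {G : Type*}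
    [Group G] [Finite G] (hG : IsPGroup p G) (hP : IsPowerful p G) {c : G}
    (hc : c ∈ powSubgroup G p) (g : G) : ∃ w, pcomm c g = w ^ p ^ 2 := by
  have : Group.IsNilpotent G := hG.isNilpotent
  obtain ⟨x, hx, hxc⟩ :=
    hP.commutator_powSubgroup_le hodd (pcomm_mem_commutator hc (mem_top g))
  obtain ⟨k, rfl⟩ := (hP.isPowerful_powSubgroup hodd).exists_pow_eq hodd (hG.to_subgroup _) hx
  obtain ⟨w, hw⟩ := hP.exists_pow_eq hodd hG k.2
  exact ⟨w, by rw [← hxc, sq, pow_mul, hw]; simp⟩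

/-- Power relations satisfied by the elements of small order in a powerful `p`-group, `p` odd. -/
structure OmegaRelations (p : ℕ) (G : Type*) [Group G] : Prop where
  mul_pow_eq_one : ∀ x y : G, x ^ p = 1 → y ^ p = 1 → (x * y) ^ p = 1
  commute_pow : ∀ g z : G, g ^ p ^ 2 = 1 → z ^ p = 1 → Commute (g ^ p) z
  commute_pow_sq : ∀ w g : G, w ^ p ^ 3 = 1 → g ^ p ^ 2 = 1 → Commute (w ^ p ^ 2) g

theorem Commute.of_subgroup {G : Type*} [Group G] {H : Subgroup G} {a b : H} (h : Commute a b) :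
    Commute (a : G) (b : G) :=
  h.map H.subtype

theorem OmegaRelations.pcomm_pow_eq_one {p : ℕ} {G : Type*} [Group G] {H : Subgroup G}
    (h : OmegaRelations p H) {z g : G} (hz : z ∈ H) (hzg : pcomm z g ∈ H) (hzp : z ^ p = 1) :
    pcomm z g ^ p = 1 := by
  have hcz : g⁻¹ * z * g ∈ H := mul_pcomm z g ▸ H.mul_mem hz hzg
  have := h.mul_pow_eq_one ⟨z⁻¹, H.inv_mem hz⟩ ⟨_, hcz⟩ (Subtype.ext (by simp [hzp]))
    (Subtype.ext (conj_pow_eq_one hzp g))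
  rw [← inv_mul_cancel_left z (pcomm z g), mul_pcomm]
  exact congrArg Subtype.val this

theorem IsPowerful.pcomm_pow_eq_one {p : ℕ} [Fact p.Prime] (hodd : Odd p) {G : Type*} [Group G]
    [Finite G] (hG : IsPGroup p G) (hP : IsPowerful p G)
    (ih : ∀ H : Subgroup G, H ≠ ⊤ → IsPowerful p H → OmegaRelations p H) {z : G} (hz : z ^ p = 1)
    (g : G) : pcomm z g ^ p = 1 := by
  have : Group.IsNilpotent G := hG.isNilpotent
  by_cases h : zpowers z ⊔ powSubgroup G p = ⊤
  · obtain ⟨k, rfl⟩ := mem_zpowers_iff.1 (hG.zpowers_eq_top_of_sup h ▸ mem_top g)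
    rw [pcomm_eq_one_iff.2 ((Commute.refl z).zpow_right k), one_pow]
  · exact (ih _ h (hP.zpowers_sup_powSubgroup hodd z)).pcomm_pow_eq_one
      (mem_sup_left (mem_zpowers z)) (mem_sup_right (hP.pcomm_mem z g)) hz

theorem IsPowerful.commute_pow_sq_of_induction {p : ℕ} [Fact p.Prime] (hodd : Odd p) {G : Type*}
    [Group G] [Finite G] (hG : IsPGroup p G) (hP : IsPowerful p G)
    (ih : ∀ H : Subgroup G, H ≠ ⊤ → IsPowerful p H → OmegaRelations p H)
    (ihq : ∀ (N : Subgroup G) [N.Normal], N ≠ ⊥ → OmegaRelations p (G ⧸ N)) {w g : G}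
    (hw : w ^ p ^ 3 = 1) (hg : g ^ p ^ 2 = 1) : Commute (w ^ p ^ 2) g := by
  have : Group.IsNilpotent G := hG.isNilpotent
  by_cases hw2 : w ^ p ^ 2 = 1
  · rw [hw2]; exact Commute.one_left g
  set K := powSubgroup G p
  have hKtop : K ≠ ⊤ := fun h =>
    hw2 (@Subsingleton.elim _ (hG.subsingleton_of_powSubgroup_eq_top h) _ _)
  have hKP : IsPowerful p K := hP.isPowerful_powSubgroup hodd
  have hK := ih K hKtop hKP
  let Ω : Subgroup G :=
    { carrier := {x | x ∈ K ∧ x ^ p = 1}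
      one_mem' := ⟨K.one_mem, one_pow p⟩
      mul_mem' := fun {a b} ha hb => ⟨K.mul_mem ha.1 hb.1, congrArg Subtype.val
        (hK.mul_pow_eq_one ⟨a, ha.1⟩ ⟨b, hb.1⟩ (Subtype.ext ha.2) (Subtype.ext hb.2))⟩
      inv_mem' := fun {a} ha => ⟨K.inv_mem ha.1, by rw [inv_pow, ha.2, inv_one]⟩ }
  have hΩ : Ω.Normal := ⟨fun a ha b =>
    ⟨(inferInstance : K.Normal).conj_mem a ha.1 b, by rw [conj_pow, ha.2]; simp⟩⟩
  have hw2Ω : w ^ p ^ 2 ∈ Ω := by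
    refine ⟨?_, by rw [← pow_mul, ← pow_succ, hw]⟩
    rw [sq, pow_mul]
    exact pow_mem_powSubgroup p _
  have hΩbot : Ω ≠ ⊥ := fun h => hw2 (mem_bot.1 (h ▸ hw2Ω))
  have huK : w ^ p ∈ K := pow_mem_powSubgroup p w
  have hu : (w ^ p) ^ p ^ 2 = 1 := by rw [← pow_mul, ← pow_succ', hw]
  have hd : pcomm (w ^ p) g ^ p = 1 := by
    have hcomm : Commute (QuotientGroup.mk' Ω w ^ p) (QuotientGroup.mk' Ω g) := by
      refine (ihq Ω hΩbot).commute_pow _ _ ?_ ?_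
      · rw [← map_pow, ← MonoidHom.mem_ker, QuotientGroup.ker_mk']
        exact hw2Ω
      · rw [← map_pow, ← MonoidHom.mem_ker, QuotientGroup.ker_mk']
        exact ⟨pow_mem_powSubgroup p g, by rw [← pow_mul, ← sq, hg]⟩
    rw [← map_pow, ← pcomm_eq_one_iff, ← map_pcomm, ← MonoidHom.mem_ker,
      QuotientGroup.ker_mk'] at hcomm
    exact hcomm.2
  obtain ⟨v, hv⟩ := hP.exists_pcomm_eq_pow_sq hodd hG huK g
  have hvK : v ^ p ∈ K := pow_mem_powSubgroup p v
  have hdv : pcomm (w ^ p) g = (v ^ p) ^ p := by rw [hv, sq, pow_mul]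
  have hv2 : (v ^ p) ^ p ^ 2 = 1 := by rw [sq, pow_mul, ← hdv, hd]
  have hdK : pcomm (w ^ p) g ∈ K := hP.pcomm_mem _ _
  have hfp : pcomm (pcomm (w ^ p) g) (w ^ p) ^ p = 1 :=
    hK.pcomm_pow_eq_one hdK (hP.pcomm_mem _ _) hd
  obtain ⟨s, hs⟩ := hKP.exists_pcomm_eq_pow_sq hodd (hG.to_subgroup K)
    (pow_mem_powSubgroup p (⟨v ^ p, hvK⟩ : K)) ⟨w ^ p, huK⟩
  have hfs : pcomm (pcomm (w ^ p) g) (w ^ p) = (s : G) ^ p ^ 2 := by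
    have := congrArg K.subtype hs
    rw [map_pcomm, map_pow, map_pow] at this
    rw [hdv]
    exact this
  have hs3 : s ^ p ^ 3 = 1 := Subtype.ext <| by
    rw [pow_succ, pow_mul]
    simpa [← hfs] using hfp
  rw [sq, pow_mul]
  apply commute_pow_of_commute_pcomm hodd hd
  · rw [hfs]
    exact (hK.commute_pow_sq s ⟨w ^ p, huK⟩ hs3 (Subtype.ext hu)).of_subgroup
  · have := (hK.commute_pow ⟨v ^ p, hvK⟩ ⟨_, hP.pcomm_mem (pcomm (w ^ p) g) (w ^ p)⟩
      (Subtype.ext hv2) (Subtype.ext hfp)).of_subgroup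
    conv_rhs => rw [hdv]
    exact this.symm

theorem IsPowerful.commute_pow_of_induction {p : ℕ} [Fact p.Prime] (hodd : Odd p) {G : Type*}
    [Group G] [Finite G] (hG : IsPGroup p G) (hP : IsPowerful p G)
    (ih : ∀ H : Subgroup G, H ≠ ⊤ → IsPowerful p H → OmegaRelations p H)
    (hsq : ∀ w g : G, w ^ p ^ 3 = 1 → g ^ p ^ 2 = 1 → Commute (w ^ p ^ 2) g) {g z : G}
    (hg : g ^ p ^ 2 = 1) (hz : z ^ p = 1) : Commute (g ^ p) z := by
  have : Group.IsNilpotent G := hG.isNilpotent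
  by_cases hKtop : powSubgroup G p = ⊤
  · exact @Subsingleton.elim _ (hG.subsingleton_of_powSubgroup_eq_top hKtop) _ _
  have hK := ih _ hKtop (hP.isPowerful_powSubgroup hodd)
  have hc : pcomm g z ^ p = 1 := by
    rw [show pcomm g z = (pcomm z g)⁻¹ by simp [pcomm, mul_assoc], inv_pow,
      hP.pcomm_pow_eq_one hodd hG ih hz, inv_one]
  have hcK := hP.pcomm_mem g z
  have heK := hP.pcomm_mem (pcomm g z) g
  have he : pcomm (pcomm g z) g ^ p = 1 := hK.pcomm_pow_eq_one hcK heK hc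
  obtain ⟨w, hw⟩ := hP.exists_pcomm_eq_pow_sq hodd hG hcK g
  have hw3 : w ^ p ^ 3 = 1 := by rw [pow_succ, pow_mul, ← hw, he]
  apply commute_pow_of_commute_pcomm hodd hc
  · rw [hw]
    exact hsq w g hw3 hg
  · rw [hw, sq, pow_mul]
    exact (hK.commute_pow ⟨w ^ p, pow_mem_powSubgroup p w⟩ ⟨_, hcK⟩
      (Subtype.ext (by simpa [← pow_mul, ← pow_succ'] using hw3)) (Subtype.ext hc)).of_subgroup

theorem IsPowerful.omegaRelations {p : ℕ} [Fact p.Prime] (hodd : Odd p) {G : Type*} [Group G]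
    [Finite G] (hG : IsPGroup p G) (hP : IsPowerful p G) : OmegaRelations p G := by
  induction hn : Nat.card G using Nat.strong_induction_on generalizing G with
  | _ n ih =>
  have ihs : ∀ H : Subgroup G, H ≠ ⊤ → IsPowerful p H → OmegaRelations p H := fun H hH hHP =>
    ih _ (hn ▸ card_subgroup_lt hH) (hG.to_subgroup H) hHP rfl
  have ihq : ∀ (N : Subgroup G) [N.Normal], N ≠ ⊥ → OmegaRelations p (G ⧸ N) := by
    intro N _ hN
    refine ih _ ?_ (hG.to_quotient N)
      (hP.of_surjective _ (QuotientGroup.mk'_surjective N)) rfl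
    rw [← hn, card_eq_card_quotient_mul_card_subgroup N]
    exact lt_mul_of_one_lt_right Nat.card_pos (N.one_lt_card_iff_ne_bot.2 hN)
  have hsq := fun w g => hP.commute_pow_sq_of_induction hodd hG ihs ihq (w := w) (g := g)
  have hpow := fun g z => hP.commute_pow_of_induction hodd hG ihs hsq (g := g) (z := z)
  refine ⟨fun x y hx hy => ?_, hpow, hsq⟩
  have hc := hP.pcomm_pow_eq_one hodd hG ihs hy x
  obtain ⟨g, hg⟩ := hP.exists_pow_eq hodd hG (hP.pcomm_mem y x)
  have hg2 : g ^ p ^ 2 = 1 := by rw [sq, pow_mul, hg, hc]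
  rw [mul_pow_of_pcomm_pow_eq_one hodd (hg ▸ hpow g x hg2 hx) (hg ▸ hpow g y hg2 hy) hc, hx, hy,
    one_mul]

/-- In a powerful `p`-group with `p` odd, `[x, y]` commutes with `z` whenever `x ^ p = z ^ p = 1`. -/
theorem IsPowerful.pcomm_pcomm_eq_one {p : ℕ} [Fact p.Prime] (hodd : Odd p) {G : Type*} [Group G]
    [Finite G] (hG : IsPGroup p G) (hP : IsPowerful p G) {x y z : G} (hx : x ^ p = 1)
    (hz : z ^ p = 1) : pcomm (pcomm x y) z = 1 := by
  obtain ⟨g, hg⟩ := hP.exists_pow_eq hodd hG (hP.pcomm_mem x y)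
  have hc := hP.pcomm_pow_eq_one hodd hG
    (fun H _ hH => hH.omegaRelations hodd (hG.to_subgroup H)) hx y
  rw [pcomm_eq_one_iff, ← hg]
  exact (hP.omegaRelations hodd hG).commute_pow g z (by rw [sq, pow_mul, hg, hc]) hz

theorem weight_four_commutator_trivial (p : ℕ) (hp : p.Prime) (hodd : Odd p)
    (G : Type*) [Group G] [Finite G]
    (hG : IsPGroup p G) (hQP : IsQuasiPowerful p G) (x y z w : G)
    (hx : x ^ p = 1) (hy : y ^ p = 1) (hz : z ^ p = 1) :
    pcomm (pcomm (pcomm x y) z) w = 1 := by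
  have : Fact p.Prime := ⟨hp⟩
  have key : ∀ g : G, g ^ p = 1 → QuotientGroup.mk' (Subgroup.center G) g ^ p = 1 := by
    intro g hg
    rw [← map_pow, hg, map_one]
  have h := IsPowerful.pcomm_pcomm_eq_one hodd (hG.to_quotient (Subgroup.center G)) hQP
    (y := QuotientGroup.mk' (Subgroup.center G) y) (key x hx) (key z hz)
  rw [← map_pcomm, ← map_pcomm, ← MonoidHom.mem_ker, QuotientGroup.ker_mk'] at h
  exact pcomm_eq_one_iff.2 (Subgroup.mem_center_iff.1 h w).symm
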